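/- arXiv:2009.11499 — 4 statements merged into one kernel-verified Lean document; each statement's English description precedes it below -/
import Mathlib

section
/- Let d, k be positive integers, W a real d×k matrix, σ² > 0, D_ε a d×d diagonal matrix with strictly positive diagonal entries, D_x a k×k diagonal matrix with strictly positive diagonal entries, M := σ²·D_x + Wᵀ·D_ε·W and N := D_ε − D_ε·W·M⁻¹·Wᵀ·D_ε. Then σ²·M⁻¹·Wᵀ·D_ε·N⁻¹ = D_x⁻¹·Wᵀ. -/
open Matrix

/-- Push-through form of the Woodbury identity: for invertible `E`, `P` and `P + V * E * U`, the
Woodbury complement `E - E * U * (P + V * E * U)⁻¹ * V * E` is cancelled on the right. -/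
theorem Matrix.inv_mul_mul_woodbury_inv {m n R : Type*} [Fintype m] [DecidableEq m] [Fintype n]
    [DecidableEq n] [CommRing R] (E : Matrix m m R) (P : Matrix n n R) (U : Matrix m n R)
    (V : Matrix n m R) (hE : IsUnit E.det) (hP : IsUnit P.det)
    (hM : IsUnit (P + V * E * U).det) :
    (P + V * E * U)⁻¹ * V * E * (E - E * U * (P + V * E * U)⁻¹ * V * E)⁻¹ = P⁻¹ * V := by
  generalize hQ : P + V * E * U = Q at hM ⊢
  have h_core : Q⁻¹ * V * E * (E⁻¹ + U * P⁻¹ * V) = P⁻¹ * V := by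
    calc Q⁻¹ * V * E * (E⁻¹ + U * P⁻¹ * V)
        = Q⁻¹ * V * (E * E⁻¹) + Q⁻¹ * (V * E * U) * P⁻¹ * V := by
          simp only [Matrix.mul_add, Matrix.mul_assoc]
      _ = Q⁻¹ * (P * P⁻¹) * V + Q⁻¹ * (V * E * U) * P⁻¹ * V := by
          rw [mul_nonsing_inv _ hE, mul_nonsing_inv _ hP, Matrix.mul_one, Matrix.mul_one]
      _ = Q⁻¹ * (P + V * E * U) * P⁻¹ * V := by
          simp only [Matrix.mul_add, Matrix.add_mul, Matrix.mul_assoc]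
      _ = P⁻¹ * V := by
          rw [hQ, nonsing_inv_mul _ hM, Matrix.one_mul]
  have h_inv : (E - E * U * Q⁻¹ * V * E) * (E⁻¹ + U * P⁻¹ * V) = 1 := by
    calc (E - E * U * Q⁻¹ * V * E) * (E⁻¹ + U * P⁻¹ * V)
        = E * E⁻¹ + E * U * (P⁻¹ * V) - E * U * (Q⁻¹ * V * E * (E⁻¹ + U * P⁻¹ * V)) := by
          simp only [Matrix.sub_mul, Matrix.mul_add, Matrix.mul_assoc]
          abel
      _ = 1 := by
          rw [h_core, mul_nonsing_inv _ hE, add_sub_cancel_right]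
  rw [inv_eq_right_inv h_inv, h_core]

/-- With `M = σ² • D_x + Wᵀ * D_ε * W` and
`N = D_ε − D_ε * W * M⁻¹ * Wᵀ * D_ε`, we have
`σ² • (M⁻¹ * Wᵀ * D_ε * N⁻¹) = D_x⁻¹ * Wᵀ`. -/
theorem stmt_3 (d k : ℕ) (hd : 0 < d) (hk : 0 < k)
    (W : Matrix (Fin d) (Fin k) ℝ) (σ2 : ℝ) (hσ2 : 0 < σ2)
    (uε : Fin d → ℝ) (huε : ∀ i, 0 < uε i)
    (vx : Fin k → ℝ) (hvx : ∀ j, 0 < vx j)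
    (M : Matrix (Fin k) (Fin k) ℝ)
    (hM : M = σ2 • Matrix.diagonal vx + Wᵀ * Matrix.diagonal uε * W)
    (N : Matrix (Fin d) (Fin d) ℝ)
    (hN : N = Matrix.diagonal uε - Matrix.diagonal uε * W * M⁻¹ * Wᵀ * Matrix.diagonal uε) :
    σ2 • (M⁻¹ * Wᵀ * Matrix.diagonal uε * N⁻¹) = (Matrix.diagonal vx)⁻¹ * Wᵀ := by
  have hP : (σ2 • Matrix.diagonal vx).PosDef := (PosDef.diagonal hvx).smul hσ2
  have hE : (Matrix.diagonal uε).PosDef := PosDef.diagonal huε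
  have hM_pos : (σ2 • Matrix.diagonal vx + Wᵀ * Matrix.diagonal uε * W).PosDef :=
    hP.add_posSemidef (by
      simpa [conjTranspose_eq_transpose_of_trivial] using
        hE.posSemidef.conjTranspose_mul_mul_same W)
  have h_unit : IsUnit (Matrix.diagonal vx).det :=
    (isUnit_iff_isUnit_det _).1 (PosDef.diagonal hvx).isUnit
  subst hM hN
  rw [inv_mul_mul_woodbury_inv _ _ _ _ ((isUnit_iff_isUnit_det _).1 hE.isUnit)
    ((isUnit_iff_isUnit_det _).1 hP.isUnit) ((isUnit_iff_isUnit_det _).1 hM_pos.isUnit),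
    ← Matrix.smul_mul]
  congr 1
  have : Invertible σ2 := invertibleOfNonzero hσ2.ne'
  rw [inv_smul _ σ2 h_unit, smul_smul, mul_invOf_self, one_smul]
end

section
/- Let d, k be positive integers, W a real d×k matrix, σ² > 0, D_ε a d×d diagonal matrix with strictly positive diagonal entries, D_x a k×k diagonal matrix with strictly positive diagonal entries, M := σ²·D_x + Wᵀ·D_ε·W, N := D_ε − D_ε·W·M⁻¹·Wᵀ·D_ε, and let μ, δ_ε ∈ ℝ^d and δ_x ∈ ℝ^k be row vectors. Then for all row vectors y ∈ ℝ^d and x ∈ ℝ^k, φ_d(y; μ + δ_ε·D_ε⁻¹ + x·Wᵀ, σ²·D_ε⁻¹) · φ_k(x; δ_x·D_x⁻¹, D_x⁻¹) = φ_k(x; μ_x(y), σ²·M⁻¹) · φ_d(y; μ_y, σ²·N⁻¹) · c, where μ_x(y) := ((y − μ − δ_ε·D_ε⁻¹)·D_ε·W + σ²·δ_x)·M⁻¹, μ_y := μ + δ_ε·D_ε⁻¹ + σ²·δ_x·M⁻¹·Wᵀ·D_ε·N⁻¹, and c := (σ²)^{k/2}·(det D_ε)^{1/2}·(det D_x)^{1/2}·(det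 M)^{−1/2}·(det N)^{−1/2}·exp(−(1/2)·δ_x·(D_x⁻¹ − σ²·M⁻¹·Wᵀ·D_ε·N⁻¹·D_ε·W·M⁻¹ − σ²·M⁻¹)·δ_xᵀ). -/
open Matrix

/-- The multivariate Gaussian density `φₙ(z; m, S)` evaluated at the row vector `z`,
with mean row vector `m` and (positive definite) covariance matrix `S`:
`(2π)^{−n/2} (det S)^{−1/2} exp(−(1/2)(z−m) S⁻¹ (z−m)ᵀ)`. -/
noncomputable def gaussDensity {n : ℕ} (z m : Fin n → ℝ) (S : Matrix (Fin n) (Fin n) ℝ) : ℝ :=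
  (2 * Real.pi) ^ (-(n : ℝ) / 2) * S.det ^ (-(1 : ℝ) / 2) *
    Real.exp (-(1 / 2) * ((z - m) ᵥ* S⁻¹ ⬝ᵥ (z - m)))

theorem gaussDensity_smul_inv {n : ℕ} (z m : Fin n → ℝ) {s : ℝ} (hs : 0 < s)
    (A : Matrix (Fin n) (Fin n) ℝ) (hA : 0 < A.det) :
    gaussDensity z m (s • A⁻¹) =
      (2 * Real.pi) ^ (-(n : ℝ) / 2) * (s ^ (-((n : ℝ) / 2)) * A.det ^ ((1 : ℝ) / 2)) *
        Real.exp (-(1 / 2) * (s⁻¹ * ((z - m) ᵥ* A ⬝ᵥ (z - m)))) := by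
  have hdet : (s • A⁻¹).det ^ (-(1 : ℝ) / 2) = s ^ (-((n : ℝ) / 2)) * A.det ^ ((1 : ℝ) / 2) := by
    rw [det_smul, det_nonsing_inv, Ring.inverse_eq_inv', Fintype.card_fin,
      Real.mul_rpow (by positivity) (by positivity), ← Real.rpow_natCast, ← Real.rpow_mul hs.le,
      Real.inv_rpow hA.le, ← Real.rpow_neg hA.le]
    congr 2 <;> ring
  have hinv : (s • A⁻¹)⁻¹ = s⁻¹ • A := by
    refine inv_eq_left_inv ?_
    rw [smul_mul_smul_comm, inv_mul_cancel₀ hs.ne', mul_nonsing_inv _ hA.ne'.isUnit, one_smul]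
  rw [gaussDensity, hdet, hinv, vecMul_smul, smul_dotProduct, smul_eq_mul]

namespace Matrix

variable {m n R : Type*} [Fintype m] [Fintype n] [CommRing R]

theorem vecMul_dotProduct (A : Matrix m n R) (u : m → R) (v : n → R) :
    u ᵥ* A ⬝ᵥ v = u ⬝ᵥ v ᵥ* Aᵀ := by
  rw [← dotProduct_mulVec, vecMul_transpose]

theorem IsSymm.vecMul_dotProduct_comm {A : Matrix n n R} (hA : A.IsSymm) (u v : n → R) :
    u ᵥ* A ⬝ᵥ v = v ᵥ* A ⬝ᵥ u := by
  rw [vecMul_dotProduct, hA.eq, dotProduct_comm]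

theorem IsSymm.sub_vecMul_dotProduct_sub {A : Matrix n n R} (hA : A.IsSymm) (u v : n → R) :
    (u - v) ᵥ* A ⬝ᵥ (u - v) = u ᵥ* A ⬝ᵥ u - 2 * (u ᵥ* A ⬝ᵥ v) + v ᵥ* A ⬝ᵥ v := by
  rw [sub_vecMul, sub_dotProduct, dotProduct_sub, dotProduct_sub, hA.vecMul_dotProduct_comm v u]
  ring

theorem IsSymm.sub_vecMul_inv_dotProduct [DecidableEq n] {A : Matrix n n R} (hA : A.IsSymm)
    (hdet : IsUnit A.det) (z b : n → R) :
    (z - b ᵥ* A⁻¹) ᵥ* A ⬝ᵥ (z - b ᵥ* A⁻¹) =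
      z ᵥ* A ⬝ᵥ z - 2 * (b ⬝ᵥ z) + b ᵥ* A⁻¹ ⬝ᵥ b := by
  rw [hA.sub_vecMul_dotProduct_sub, hA.vecMul_dotProduct_comm z (b ᵥ* A⁻¹), vecMul_vecMul,
    nonsing_inv_mul _ hdet, vecMul_one, dotProduct_comm b (b ᵥ* A⁻¹)]

theorem det_mul_det_sub_mul_inv_mul [DecidableEq m] [DecidableEq n] (E : Matrix m m R)
    (D : Matrix n n R) (W : Matrix m n R) (hE : IsUnit E.det)
    (hM : IsUnit (D + Wᵀ * E * W).det) :
    (D + Wᵀ * E * W).det * (E - E * W * (D + Wᵀ * E * W)⁻¹ * Wᵀ * E).det = E.det * D.det := by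
  let _ := invertibleOfIsUnitDet _ hE
  let _ := invertibleOfIsUnitDet _ hM
  have h := (det_fromBlocks₂₂ E (E * W) (Wᵀ * E) (D + Wᵀ * E * W)).symm.trans
    (det_fromBlocks₁₁ E (E * W) (Wᵀ * E) (D + Wᵀ * E * W))
  rw [invOf_eq_nonsing_inv, invOf_eq_nonsing_inv] at h
  convert h using 3
  · simp only [Matrix.mul_assoc]
  · rw [Matrix.mul_assoc _ E⁻¹, nonsing_inv_mul_cancel_left _ _ hE, add_sub_cancel_right]

end Matrix

theorem quadratic_form_factorization {m n K : Type*} [Fintype m] [Fintype n] [DecidableEq m]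
    [DecidableEq n] [Field K] {s : K} (hs : s ≠ 0) {E N : Matrix m m K} {D M : Matrix n n K}
    {W : Matrix m n K} (hE : E.IsSymm) (hD : D.IsSymm) (hDdet : IsUnit D.det)
    (hMdet : IsUnit M.det) (hNdet : IsUnit N.det) (hM : M = s • D + Wᵀ * E * W)
    (hN : N = E - E * W * M⁻¹ * Wᵀ * E) (e : m → K) (x δ : n → K) :
    s⁻¹ * ((e - x ᵥ* Wᵀ) ᵥ* E ⬝ᵥ (e - x ᵥ* Wᵀ)) +
        (x - δ ᵥ* D⁻¹) ᵥ* D ⬝ᵥ (x - δ ᵥ* D⁻¹) =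
      s⁻¹ * ((x - (e ᵥ* (E * W) + s • δ) ᵥ* M⁻¹) ᵥ* M ⬝ᵥ
          (x - (e ᵥ* (E * W) + s • δ) ᵥ* M⁻¹)) +
        s⁻¹ * ((e - s • (δ ᵥ* (M⁻¹ * Wᵀ * E * N⁻¹))) ᵥ* N ⬝ᵥ
          (e - s • (δ ᵥ* (M⁻¹ * Wᵀ * E * N⁻¹)))) +
        δ ᵥ* (D⁻¹ - s • (M⁻¹ * Wᵀ * E * N⁻¹ * E * W * M⁻¹) - s • M⁻¹) ⬝ᵥ δ := by
  have hMs : M.IsSymm := by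
    simp [IsSymm, hM, hE.eq, hD.eq, Matrix.mul_assoc]
  have hMi : (M⁻¹).IsSymm := by rw [IsSymm, transpose_nonsing_inv, hMs.eq]
  have hNs : N.IsSymm := by
    simp [IsSymm, hN, hE.eq, hMi.eq, Matrix.mul_assoc]
  have ha : s • (δ ᵥ* (M⁻¹ * Wᵀ * E * N⁻¹)) = (s • (δ ᵥ* (M⁻¹ * Wᵀ * E))) ᵥ* N⁻¹ := by
    rw [smul_vecMul, vecMul_vecMul]
  have hcross : δ ᵥ* (M⁻¹ * Wᵀ * E) ⬝ᵥ e = e ᵥ* (E * W) ᵥ* M⁻¹ ⬝ᵥ δ := by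
    rw [vecMul_vecMul, vecMul_dotProduct, dotProduct_comm]
    simp [hE.eq, hMi.eq, Matrix.mul_assoc]
  have hxx : x ᵥ* Wᵀ ᵥ* E ⬝ᵥ x ᵥ* Wᵀ = x ᵥ* (Wᵀ * E * W) ⬝ᵥ x := by
    rw [vecMul_vecMul, ← vecMul_dotProduct, vecMul_vecMul]
  have hex : e ᵥ* E ⬝ᵥ x ᵥ* Wᵀ = e ᵥ* (E * W) ⬝ᵥ x := by
    rw [← vecMul_dotProduct, vecMul_vecMul]
  have haa : δ ᵥ* (M⁻¹ * Wᵀ * E) ᵥ* N⁻¹ ⬝ᵥ δ ᵥ* (M⁻¹ * Wᵀ * E) =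
      δ ᵥ* (M⁻¹ * Wᵀ * E * N⁻¹ * E * W * M⁻¹) ⬝ᵥ δ := by
    have h : M⁻¹ * Wᵀ * E = (E * W * M⁻¹)ᵀ := by
      simp [hE.eq, hMi.eq, Matrix.mul_assoc]
    conv_lhs => rw [vecMul_vecMul]; arg 2; rw [h]
    rw [← vecMul_dotProduct, vecMul_vecMul]
    simp only [Matrix.mul_assoc]
  have hMx : x ᵥ* M ⬝ᵥ x = s * (x ᵥ* D ⬝ᵥ x) + x ᵥ* (Wᵀ * E * W) ⬝ᵥ x := by
    rw [hM, vecMul_add, add_dotProduct, vecMul_smul, smul_dotProduct, smul_eq_mul]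
  have hNe : e ᵥ* N ⬝ᵥ e = e ᵥ* E ⬝ᵥ e - e ᵥ* (E * W) ᵥ* M⁻¹ ⬝ᵥ e ᵥ* (E * W) := by
    have h : E * W * M⁻¹ * Wᵀ * E = E * W * M⁻¹ * (E * W)ᵀ := by
      simp [hE.eq, Matrix.mul_assoc]
    rw [hN, vecMul_sub, sub_dotProduct, h, vecMul_vecMul, ← vecMul_vecMul _ _ (E * W)ᵀ,
      vecMul_dotProduct (E * W)ᵀ, transpose_transpose]
  rw [ha, hE.sub_vecMul_dotProduct_sub, hD.sub_vecMul_inv_dotProduct hDdet,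
    hMs.sub_vecMul_inv_dotProduct hMdet, hNs.sub_vecMul_inv_dotProduct hNdet]
  simp only [add_vecMul, smul_vecMul, vecMul_sub, vecMul_smul, add_dotProduct, dotProduct_add,
    sub_dotProduct, smul_dotProduct, dotProduct_smul, smul_eq_mul]
  rw [hcross, haa, hxx, hex, hMx, hNe, hMi.vecMul_dotProduct_comm δ]
  field_simp
  ring

/-- Density factorization of the joint law of `(Y_t, X_t)` given the scale
variables in the Generalized Skew-t PPCA model: with `M = σ² • D_x + Wᵀ D_ε W`,
`N = D_ε − D_ε W M⁻¹ Wᵀ D_ε`, for all row vectors `y ∈ ℝ^d`, `x ∈ ℝ^k`,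
`φ_d(y; μ + δ_ε D_ε⁻¹ + x Wᵀ, σ² D_ε⁻¹) ⬝ φ_k(x; δ_x D_x⁻¹, D_x⁻¹)
  = φ_k(x; μ_x(y), σ² M⁻¹) ⬝ φ_d(y; μ_y, σ² N⁻¹) ⬝ c`. -/
theorem stmt_6 (d k : ℕ) (hd : 0 < d) (hk : 0 < k)
    (W : Matrix (Fin d) (Fin k) ℝ) (σ2 : ℝ) (hσ2 : 0 < σ2)
    (uε : Fin d → ℝ) (huε : ∀ i, 0 < uε i)
    (vx : Fin k → ℝ) (hvx : ∀ j, 0 < vx j)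
    (μ δε : Fin d → ℝ) (δx : Fin k → ℝ)
    (M : Matrix (Fin k) (Fin k) ℝ)
    (hM : M = σ2 • Matrix.diagonal vx + Wᵀ * Matrix.diagonal uε * W)
    (N : Matrix (Fin d) (Fin d) ℝ)
    (hN : N = Matrix.diagonal uε - Matrix.diagonal uε * W * M⁻¹ * Wᵀ * Matrix.diagonal uε)
    (c : ℝ)
    (hc : c = σ2 ^ ((k : ℝ) / 2) * (Matrix.diagonal uε).det ^ ((1 : ℝ) / 2)
        * (Matrix.diagonal vx).det ^ ((1 : ℝ) / 2)
        * M.det ^ (-(1 : ℝ) / 2) * N.det ^ (-(1 : ℝ) / 2)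
        * Real.exp (-(1 / 2) *
            ((δx ᵥ* ((Matrix.diagonal vx)⁻¹
                - σ2 • (M⁻¹ * Wᵀ * Matrix.diagonal uε * N⁻¹ * Matrix.diagonal uε * W * M⁻¹)
                - σ2 • M⁻¹)) ⬝ᵥ δx))) :
    ∀ (y : Fin d → ℝ) (x : Fin k → ℝ),
      gaussDensity y (μ + δε ᵥ* (Matrix.diagonal uε)⁻¹ + x ᵥ* Wᵀ) (σ2 • (Matrix.diagonal uε)⁻¹)
          * gaussDensity x (δx ᵥ* (Matrix.diagonal vx)⁻¹) ((Matrix.diagonal vx)⁻¹)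
        = gaussDensity x
              (((y - μ - δε ᵥ* (Matrix.diagonal uε)⁻¹) ᵥ* (Matrix.diagonal uε * W) + σ2 • δx)
                ᵥ* M⁻¹)
              (σ2 • M⁻¹)
          * gaussDensity y
              (μ + δε ᵥ* (Matrix.diagonal uε)⁻¹
                + σ2 • (δx ᵥ* (M⁻¹ * Wᵀ * Matrix.diagonal uε * N⁻¹)))
              (σ2 • N⁻¹)
          * c := by
  intro y x
  have hu : 0 < (diagonal uε).det := by
    rw [det_diagonal]; exact Finset.prod_pos fun i _ => huε i
  have hv : 0 < (diagonal vx).det := by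
    rw [det_diagonal]; exact Finset.prod_pos fun j _ => hvx j
  have hMpos : 0 < M.det := by
    have h1 : (σ2 • diagonal vx).PosDef := (PosDef.diagonal hvx).smul hσ2
    have h2 : (Wᵀ * diagonal uε * W).PosSemidef := by
      simpa using (PosDef.diagonal huε).posSemidef.conjTranspose_mul_mul_same W
    rw [hM]
    exact (h1.add_posSemidef h2).det_pos
  have hNpos : 0 < N.det := by
    have h := det_mul_det_sub_mul_inv_mul (diagonal uε) (σ2 • diagonal vx) W hu.ne'.isUnit
      (hM ▸ hMpos.ne'.isUnit)
    rw [← hM, ← hN, det_smul] at h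
    exact pos_of_mul_pos_right (h ▸ by positivity) hMpos.le
  have hquad := quadratic_form_factorization hσ2.ne' (isSymm_diagonal uε) (isSymm_diagonal vx)
    hv.ne'.isUnit hMpos.ne'.isUnit hNpos.ne'.isUnit hM hN
    (y - μ - δε ᵥ* (diagonal uε)⁻¹) x δx
  have hpow {n : ℕ} {A : Matrix (Fin n) (Fin n) ℝ} (hA : 0 < A.det) :
      A.det ^ ((1 : ℝ) / 2) * A.det ^ (-(1 : ℝ) / 2) = 1 := by
    rw [← Real.rpow_add hA]; norm_num
  have hσ : σ2 ^ (-((k : ℝ) / 2)) * σ2 ^ ((k : ℝ) / 2) = 1 := by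
    rw [← Real.rpow_add hσ2]; norm_num
  have hone := congrArg₂ (· * ·) hσ (congrArg₂ (· * ·) (hpow hMpos) (hpow hNpos))
  simp only [mul_one] at hone
  have hexp := congrArg (fun t => Real.exp (-(1 / 2) * t)) hquad
  simp only [mul_add, Real.exp_add] at hexp
  rw [hc, ← one_smul ℝ (diagonal vx)⁻¹, gaussDensity_smul_inv _ _ hσ2 _ hu,
    gaussDensity_smul_inv _ _ one_pos _ hv, gaussDensity_smul_inv _ _ hσ2 _ hMpos,
    gaussDensity_smul_inv _ _ hσ2 _ hNpos, one_smul, inv_one, one_mul, Real.one_rpow, one_mul]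
  simp only [← sub_sub]
  rw [mul_mul_mul_comm, hexp]
  refine (mul_one _).symm.trans ((congrArg _ hone.symm).trans ?_)
  ring
end

section
/- Let d, k be positive integers, W a real d×k matrix, σ > 0, and let u ∈ ℝ^d and v ∈ ℝ^k have strictly positive entries; set D_ε := diag(u), D_x := diag(v), M := σ²·D_x + Wᵀ·D_ε·W and N := D_ε − D_ε·W·M⁻¹·Wᵀ·D_ε. Let Z_x be a standard Gaussian random row vector in ℝ^k and Z_ε a standard Gaussian random row vector in ℝ^d, independent of each other, and let μ, δ_ε ∈ ℝ^d, δ_x ∈ ℝ^k. Define X := δ_x·D_x⁻¹ + Z_x·D_x^{−1/2}, ε := δ_ε·D_ε⁻¹ + σ·Z_ε·D_ε^{−1/2}, and Y := μ + X·Wᵀ + ε. Then Y has a multivariate Gaussian distribution with mean μ + δ_ε·D_ε⁻¹ + δ_x·D_x⁻¹·Wᵀ and covariance matrix W·D_x⁻¹·Wᵀ + σ²·D_ε⁻¹; moreover this mean equals μ + δ_ε·D_ε⁻¹ + σ²·δ_x·M⁻¹·Wᵀ·D_ε·N⁻¹ and this covariance equals σ²·N⁻¹. -/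
open Matrix MeasureTheory ProbabilityTheory

/-- The law of a standard Gaussian random row vector in `ℝⁿ`:
the product of `n` independent standard normal distributions. -/
noncomputable def stdGaussianPi (n : ℕ) : Measure (Fin n → ℝ) :=
  Measure.pi fun _ => gaussianReal 0 1

/-- `Y` has the multivariate Gaussian distribution with mean row vector `m` and covariance
matrix `S`: its law is the pushforward of the standard Gaussian law under an affine map
`z ↦ m + z A` with `Aᵀ A = S`. -/
def HasGaussianLaw {Ω : Type*} [MeasureSpace Ω] {n : ℕ}
    (Y : Ω → Fin n → ℝ) (m : Fin n → ℝ) (S : Matrix (Fin n) (Fin n) ℝ) : Prop :=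
  ∃ A : Matrix (Fin n) (Fin n) ℝ, Aᵀ * A = S ∧
    Measure.map Y ℙ = Measure.map (fun z => m + z ᵥ* A) (stdGaussianPi n)

open scoped MatrixOrder in
lemma Matrix.PosSemidef.exists_transpose_mul_self_eq {n : Type*} [Fintype n] [DecidableEq n]
    {S : Matrix n n ℝ} (hS : S.PosSemidef) : ∃ A : Matrix n n ℝ, Aᵀ * A = S := by
  obtain ⟨A, hA⟩ := CStarAlgebra.nonneg_iff_eq_star_mul_self.mp hS.nonneg
  exact ⟨A, by simp [hA, star_eq_conjTranspose]⟩

instance isProbabilityMeasure_stdGaussianPi (n : ℕ) :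
    IsProbabilityMeasure (stdGaussianPi n) := by
  unfold stdGaussianPi; infer_instance

lemma integral_cexp_dotProduct_stdGaussianPi {n : ℕ} (c : Fin n → ℝ) :
    ∫ z, Complex.exp (((z ⬝ᵥ c : ℝ) : ℂ) * Complex.I) ∂stdGaussianPi n
      = Complex.exp (-((c ⬝ᵥ c : ℝ) : ℂ) / 2) := by
  have h (z : Fin n → ℝ) : Complex.exp (((z ⬝ᵥ c : ℝ) : ℂ) * Complex.I)
      = ∏ i, Complex.exp ((c i : ℂ) * (z i : ℂ) * Complex.I) := by
    rw [← Complex.exp_sum, ← Finset.sum_mul]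
    simp [dotProduct, mul_comm]
  simp_rw [h, stdGaussianPi]
  rw [integral_fintype_prod_eq_prod
    (f := fun i (x : ℝ) => Complex.exp ((c i : ℂ) * (x : ℂ) * Complex.I))]
  simp_rw [← charFun_apply_real, charFun_gaussianReal]
  rw [← Complex.exp_sum]
  simp [dotProduct, Finset.sum_div, pow_two, neg_div]

lemma StrongDual.apply_eq_dotProduct {n : ℕ} (L : StrongDual ℝ (Fin n → ℝ)) (x : Fin n → ℝ) :
    L x = x ⬝ᵥ fun i => L (Pi.single i 1) := by
  conv_lhs => rw [pi_eq_sum_univ' x]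
  simp [dotProduct]

lemma map_add_vecMul_stdGaussianPi_eq {p q n : ℕ} (m : Fin n → ℝ) (A : Matrix (Fin n) (Fin n) ℝ)
    (B : Matrix (Fin p) (Fin n) ℝ) (C : Matrix (Fin q) (Fin n) ℝ)
    (h : Aᵀ * A = Bᵀ * B + Cᵀ * C) :
    Measure.map (fun z : (Fin p → ℝ) × (Fin q → ℝ) => m + z.1 ᵥ* B + z.2 ᵥ* C)
        ((stdGaussianPi p).prod (stdGaussianPi q))
      = Measure.map (fun z => m + z ᵥ* A) (stdGaussianPi n) := by
  have hm {k : ℕ} (T : Matrix (Fin k) (Fin n) ℝ) : Continuous fun z => z ᵥ* T :=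
    continuous_id.matrix_vecMul continuous_const
  have hA : Continuous fun z => m + z ᵥ* A := continuous_const.add (hm A)
  have hBC : Continuous fun z : (Fin p → ℝ) × (Fin q → ℝ) => m + z.1 ᵥ* B + z.2 ᵥ* C :=
    (continuous_const.add ((hm B).comp continuous_fst)).add ((hm C).comp continuous_snd)
  have := Measure.isProbabilityMeasure_map (μ := stdGaussianPi n) hA.measurable.aemeasurable
  have := Measure.isProbabilityMeasure_map
    (μ := (stdGaussianPi p).prod (stdGaussianPi q)) hBC.measurable.aemeasurable
  refine Measure.ext_of_charFunDual (funext fun L => ?_)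
  have hL : Continuous fun x => Complex.exp ((L x : ℂ) * Complex.I) := by fun_prop
  rw [charFunDual_apply, charFunDual_apply,
    integral_map hA.measurable.aemeasurable hL.aestronglyMeasurable,
    integral_map hBC.measurable.aemeasurable hL.aestronglyMeasurable]
  set t : Fin n → ℝ := fun i => L (Pi.single i 1)
  have hvm {k : ℕ} (T : Matrix (Fin k) (Fin n) ℝ) (z : Fin k → ℝ) :
      L (z ᵥ* T) = z ⬝ᵥ (T *ᵥ t) := by
    rw [StrongDual.apply_eq_dotProduct, dotProduct_mulVec]
  have hq {k : ℕ} (T : Matrix (Fin k) (Fin n) ℝ) :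
      (T *ᵥ t) ⬝ᵥ (T *ᵥ t) = t ⬝ᵥ ((Tᵀ * T) *ᵥ t) := by
    rw [← mulVec_mulVec, dotProduct_mulVec t, vecMul_transpose]
  simp_rw [map_add, hvm, Complex.ofReal_add, add_mul, Complex.exp_add, mul_assoc]
  rw [integral_const_mul, integral_const_mul,
    integral_prod_mul (fun z : Fin p → ℝ => Complex.exp (((z ⬝ᵥ B *ᵥ t : ℝ) : ℂ) * Complex.I))
      (fun z : Fin q → ℝ => Complex.exp (((z ⬝ᵥ C *ᵥ t : ℝ) : ℂ) * Complex.I))]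
  simp_rw [integral_cexp_dotProduct_stdGaussianPi, ← Complex.exp_add, hq, h, add_mulVec,
    dotProduct_add]
  push_cast
  ring_nf

/-- A Woodbury-type identity: `N = a - a W M⁻¹ Wᵀ a` is, up to the factor `s`, the inverse of
`W b⁻¹ Wᵀ + s a⁻¹`, where `M = s b + Wᵀ a W`. -/
lemma woodbury_mul_eq_smul_one {m n : Type*} [Fintype m] [Fintype n] [DecidableEq m]
    [DecidableEq n] (W : Matrix m n ℝ) (s : ℝ) {a : Matrix m m ℝ} {b M : Matrix n n ℝ}
    (ha : IsUnit a.det) (hb : IsUnit b.det) (hM : IsUnit M.det)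
    (h : M = s • b + Wᵀ * a * W) :
    M⁻¹ * Wᵀ * a * (W * b⁻¹ * Wᵀ + s • a⁻¹) = b⁻¹ * Wᵀ ∧
    (a - a * W * M⁻¹ * Wᵀ * a) * (W * b⁻¹ * Wᵀ + s • a⁻¹) = s • 1 := by
  have h1 : M⁻¹ * Wᵀ * a * (W * b⁻¹ * Wᵀ + s • a⁻¹) = b⁻¹ * Wᵀ := by
    have e : M⁻¹ * Wᵀ * a * (W * b⁻¹ * Wᵀ + s • a⁻¹)
        = M⁻¹ * ((s • b + Wᵀ * a * W) * b⁻¹ * Wᵀ) := by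
      rw [Matrix.mul_add, Matrix.mul_smul, mul_nonsing_inv_cancel_right _ _ ha, Matrix.add_mul,
        Matrix.add_mul, Matrix.smul_mul, mul_nonsing_inv _ hb, Matrix.smul_mul, Matrix.one_mul,
        Matrix.mul_add, Matrix.mul_smul, add_comm]
      simp only [Matrix.mul_assoc]
    rw [e, ← h, Matrix.mul_assoc, nonsing_inv_mul_cancel_left _ _ hM]
  refine ⟨h1, ?_⟩
  have e : a * W * M⁻¹ * Wᵀ * a = a * W * (M⁻¹ * Wᵀ * a) := by simp only [Matrix.mul_assoc]
  rw [e, Matrix.sub_mul, Matrix.mul_assoc (a * W), h1, Matrix.mul_add, Matrix.mul_smul,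
    mul_nonsing_inv _ ha]
  simp only [Matrix.mul_assoc, add_sub_cancel_left]

/-- Conditional law of the observation vector `Y = μ + X Wᵀ + ε` of the
Generalized Skew-t PPCA model given the scale variables: with `D_ε = diagonal u`,
`D_x = diagonal v`, `X = δ_x D_x⁻¹ + Z_x D_x^{−1/2}`, `ε = δ_ε D_ε⁻¹ + σ Z_ε D_ε^{−1/2}`,
the vector `Y` is multivariate Gaussian with mean `μ + δ_ε D_ε⁻¹ + δ_x D_x⁻¹ Wᵀ` and
covariance `W D_x⁻¹ Wᵀ + σ² D_ε⁻¹`; moreover this mean equals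
`μ + δ_ε D_ε⁻¹ + σ² δ_x M⁻¹ Wᵀ D_ε N⁻¹` and this covariance equals `σ² N⁻¹`. -/
theorem stmt_7 {Ω : Type*} [MeasureSpace Ω] [IsProbabilityMeasure (ℙ : Measure Ω)]
    (d k : ℕ) (hd : 0 < d) (hk : 0 < k)
    (W : Matrix (Fin d) (Fin k) ℝ) (σ : ℝ) (hσ : 0 < σ)
    (u : Fin d → ℝ) (hu : ∀ i, 0 < u i)
    (v : Fin k → ℝ) (hv : ∀ j, 0 < v j)
    (M : Matrix (Fin k) (Fin k) ℝ)
    (hM : M = σ ^ 2 • Matrix.diagonal v + Wᵀ * Matrix.diagonal u * W)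
    (N : Matrix (Fin d) (Fin d) ℝ)
    (hN : N = Matrix.diagonal u - Matrix.diagonal u * W * M⁻¹ * Wᵀ * Matrix.diagonal u)
    (Zx : Ω → Fin k → ℝ) (Zε : Ω → Fin d → ℝ)
    (hZxm : Measurable Zx) (hZεm : Measurable Zε)
    (hZx : Measure.map Zx ℙ = stdGaussianPi k)
    (hZε : Measure.map Zε ℙ = stdGaussianPi d)
    (hindep : IndepFun Zx Zε ℙ)
    (μ δε : Fin d → ℝ) (δx : Fin k → ℝ)
    (X : Ω → Fin k → ℝ)
    (hX : X = fun ω => δx ᵥ* (Matrix.diagonal v)⁻¹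
        + Zx ω ᵥ* Matrix.diagonal (fun j => (Real.sqrt (v j))⁻¹))
    (ε : Ω → Fin d → ℝ)
    (hε : ε = fun ω => δε ᵥ* (Matrix.diagonal u)⁻¹
        + σ • (Zε ω ᵥ* Matrix.diagonal (fun i => (Real.sqrt (u i))⁻¹)))
    (Y : Ω → Fin d → ℝ)
    (hY : Y = fun ω => μ + X ω ᵥ* Wᵀ + ε ω) :
    HasGaussianLaw Y
        (μ + δε ᵥ* (Matrix.diagonal u)⁻¹ + δx ᵥ* ((Matrix.diagonal v)⁻¹ * Wᵀ))
        (W * (Matrix.diagonal v)⁻¹ * Wᵀ + σ ^ 2 • (Matrix.diagonal u)⁻¹) ∧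
      μ + δε ᵥ* (Matrix.diagonal u)⁻¹ + δx ᵥ* ((Matrix.diagonal v)⁻¹ * Wᵀ)
        = μ + δε ᵥ* (Matrix.diagonal u)⁻¹
            + σ ^ 2 • (δx ᵥ* (M⁻¹ * Wᵀ * Matrix.diagonal u * N⁻¹)) ∧
      W * (Matrix.diagonal v)⁻¹ * Wᵀ + σ ^ 2 • (Matrix.diagonal u)⁻¹ = σ ^ 2 • N⁻¹ := by
  have hσ2 : 0 < σ ^ 2 := by positivity
  have hDu : (diagonal u).PosDef := PosDef.diagonal hu
  have hDv : (diagonal v).PosDef := PosDef.diagonal hv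
  have hMpos : M.PosDef := by
    rw [hM]
    refine (hDv.smul hσ2).add_posSemidef ?_
    simpa using hDu.posSemidef.conjTranspose_mul_mul_same W
  obtain ⟨hmean, hNS⟩ := woodbury_mul_eq_smul_one W (σ ^ 2)
    ((isUnit_iff_isUnit_det _).mp hDu.isUnit) ((isUnit_iff_isUnit_det _).mp hDv.isUnit)
    ((isUnit_iff_isUnit_det _).mp hMpos.isUnit) hM
  rw [← hN] at hNS
  have hcov : W * (diagonal v)⁻¹ * Wᵀ + σ ^ 2 • (diagonal u)⁻¹ = σ ^ 2 • N⁻¹ := by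
    have hNinv : N⁻¹ = (σ ^ 2)⁻¹ • (W * (diagonal v)⁻¹ * Wᵀ + σ ^ 2 • (diagonal u)⁻¹) := by
      refine inv_eq_right_inv ?_
      rw [Matrix.mul_smul, hNS, smul_smul, inv_mul_cancel₀ hσ2.ne', one_smul]
    rw [hNinv, smul_smul, mul_inv_cancel₀ hσ2.ne', one_smul]
  refine ⟨?_, ?_, hcov⟩
  · set B : Matrix (Fin k) (Fin d) ℝ := diagonal (fun j => (√(v j))⁻¹) * Wᵀ with hB
    set C : Matrix (Fin d) (Fin d) ℝ := σ • diagonal (fun i => (√(u i))⁻¹) with hC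
    have hsq {n : ℕ} (w : Fin n → ℝ) (hw : ∀ i, 0 < w i) :
        diagonal (fun i => (√(w i))⁻¹) * diagonal (fun i => (√(w i))⁻¹) = (diagonal w)⁻¹ := by
      refine (inv_eq_right_inv ?_).symm
      rw [diagonal_mul_diagonal, diagonal_mul_diagonal, ← diagonal_one]
      congr 1
      funext i
      rw [← mul_inv, Real.mul_self_sqrt (hw i).le, mul_inv_cancel₀ (hw i).ne']
    have hBB : Bᵀ * B = W * (diagonal v)⁻¹ * Wᵀ := by
      rw [← hsq v hv, hB, transpose_mul, transpose_transpose, diagonal_transpose]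
      simp only [Matrix.mul_assoc]
    have hCC : Cᵀ * C = σ ^ 2 • (diagonal u)⁻¹ := by
      rw [← hsq u hu, hC, transpose_smul, diagonal_transpose, Matrix.smul_mul, Matrix.mul_smul,
        smul_smul, pow_two]
    rw [← hBB, ← hCC]
    have hpos : (Bᵀ * B + Cᵀ * C).PosSemidef := by
      simpa using (posSemidef_conjTranspose_mul_self B).add (posSemidef_conjTranspose_mul_self C)
    obtain ⟨A, hA⟩ := hpos.exists_transpose_mul_self_eq
    refine ⟨A, hA, ?_⟩
    rw [← map_add_vecMul_stdGaussianPi_eq _ A B C hA, ← hZx, ← hZε,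
      ← hindep.map_prod_eq_prod_map_map hZxm.aemeasurable hZεm.aemeasurable,
      Measure.map_map _ (hZxm.prodMk hZεm)]
    · congr 1
      funext ω
      simp only [hY, hX, hε, hB, hC, Function.comp_apply, add_vecMul, vecMul_vecMul, vecMul_smul]
      abel
    · have hm {k : ℕ} (T : Matrix (Fin k) (Fin d) ℝ) : Continuous fun z => z ᵥ* T :=
        continuous_id.matrix_vecMul continuous_const
      exact ((continuous_const.add ((hm B).comp continuous_fst)).add
        ((hm C).comp continuous_snd)).measurable
  · rw [← vecMul_smul, ← Matrix.mul_smul, ← hcov, hmean]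
end

section
/- Let k be a positive integer, ν a real number, δ ∈ ℝ^k a row vector, V a random variable with distribution Gamma(ν/2, ν/2), and Z a standard Gaussian random row vector in ℝ^k independent of V. Define the random row vector X := V⁻¹·δ + V^{−1/2}·Z. If ν > 2 then E[X] = (ν/(ν−2))·δ, and if ν > 4 then the covariance matrix of X equals (ν/(ν−2))·I_k + (2ν²/((ν−2)²·(ν−4)))·δᵀ·δ. -/
open Matrix MeasureTheory ProbabilityTheory

/-- Mean vector `E[X]` of a random row vector `X`. -/
noncomputable def meanVec {Ω : Type*} [MeasureSpace Ω] {n : ℕ}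
    (X : Ω → Fin n → ℝ) : Fin n → ℝ :=
  fun i => ∫ ω, X ω i

/-- Covariance matrix `E[(X − E X)ᵀ (X − E X)]` of a random row vector `X`. -/
noncomputable def covMatrix {Ω : Type*} [MeasureSpace Ω] {n : ℕ}
    (X : Ω → Fin n → ℝ) : Matrix (Fin n) (Fin n) ℝ :=
  Matrix.of fun i j => ∫ ω, (X ω i - meanVec X i) * (X ω j - meanVec X j)

section GammaMoments

variable {a r : ℝ}

lemma ae_pos_gammaMeasure : ∀ᵐ x ∂gammaMeasure a r, 0 < x := by
  have hm : Measurable (gammaPDF a r) := (measurable_gammaPDFReal a r).ennreal_ofReal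
  rw [gammaMeasure, ae_withDensity_iff hm]
  filter_upwards [Measure.ae_ne volume (0 : ℝ)] with x hx h
  by_contra hneg
  exact h (gammaPDF_of_neg (lt_of_le_of_ne (not_lt.mp hneg) hx))

lemma gammaPDF_toReal_smul_rpow_ae_eq (ha : 0 < a) (hr : 0 < r) (s : ℝ) :
    (fun x => (gammaPDF a r x).toReal • x ^ s) =ᵐ[volume]
      (Set.Ioi 0).indicator
        (fun x => r ^ a / Real.Gamma a * (x ^ (a + s - 1) * Real.exp (-(r * x)))) := by
  filter_upwards [Measure.ae_ne volume (0 : ℝ)] with x hx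
  rw [gammaPDF, ENNReal.toReal_ofReal (gammaPDFReal_nonneg ha hr x), gammaPDFReal]
  rcases lt_or_gt_of_ne hx with h | h
  · simp [h.not_ge, h.le]
  · rw [Set.indicator_of_mem (Set.mem_Ioi.mpr h), if_pos h.le,
      show a + s - 1 = (a - 1) + s by ring, Real.rpow_add h, smul_eq_mul]
    ring

lemma integrable_rpow_gammaMeasure (ha : 0 < a) (hr : 0 < r) {s : ℝ} (hs : 0 < a + s) :
    Integrable (fun x => x ^ s) (gammaMeasure a r) := by
  have hm : Measurable (gammaPDF a r) := (measurable_gammaPDFReal a r).ennreal_ofReal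
  rw [gammaMeasure, integrable_withDensity_iff_integrable_smul' hm
    (ae_of_all _ fun _ => ENNReal.ofReal_lt_top),
    integrable_congr (gammaPDF_toReal_smul_rpow_ae_eq ha hr s),
    integrable_indicator_iff measurableSet_Ioi]
  refine Integrable.const_mul ?_ _
  have h := integrableOn_rpow_mul_exp_neg_mul_rpow (s := a + s - 1) (p := 1) (b := r)
    (by linarith) one_pos hr
  simpa [IntegrableOn] using h

lemma integral_rpow_gammaMeasure (ha : 0 < a) (hr : 0 < r) {s : ℝ} (hs : 0 < a + s) :
    ∫ x, x ^ s ∂gammaMeasure a r = Real.Gamma (a + s) / Real.Gamma a * r ^ (-s) := by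
  have hm : Measurable (gammaPDF a r) := (measurable_gammaPDFReal a r).ennreal_ofReal
  rw [gammaMeasure, integral_withDensity_eq_integral_toReal_smul hm
    (ae_of_all _ fun _ => ENNReal.ofReal_lt_top),
    integral_congr_ae (gammaPDF_toReal_smul_rpow_ae_eq ha hr s),
    integral_indicator measurableSet_Ioi, integral_const_mul,
    Real.integral_rpow_mul_exp_neg_mul_Ioi hs hr, one_div, Real.inv_rpow hr.le,
    ← Real.rpow_neg hr.le, show -s = a + -(a + s) by ring, Real.rpow_add hr]
  ring

lemma inv_ae_eq_rpow_gammaMeasure :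
    (fun x : ℝ => x⁻¹) =ᵐ[gammaMeasure a r] fun x => x ^ (-1 : ℝ) := by
  filter_upwards [ae_pos_gammaMeasure] with x hx
  rw [Real.rpow_neg hx.le, Real.rpow_one]

lemma inv_sq_ae_eq_rpow_gammaMeasure :
    (fun x : ℝ => x⁻¹ ^ 2) =ᵐ[gammaMeasure a r] fun x => x ^ (-2 : ℝ) := by
  filter_upwards [ae_pos_gammaMeasure] with x hx
  rw [Real.rpow_neg hx.le, Real.rpow_two, inv_pow]

lemma integrable_inv_gammaMeasure (ha : 1 < a) (hr : 0 < r) :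
    Integrable (fun x => x⁻¹) (gammaMeasure a r) :=
  (integrable_rpow_gammaMeasure (by linarith) hr (by linarith)).congr
    inv_ae_eq_rpow_gammaMeasure.symm

lemma integral_inv_gammaMeasure (ha : 1 < a) (hr : 0 < r) :
    ∫ x, x⁻¹ ∂gammaMeasure a r = r / (a - 1) := by
  rw [integral_congr_ae inv_ae_eq_rpow_gammaMeasure,
    integral_rpow_gammaMeasure (by linarith) hr (by linarith), neg_neg, Real.rpow_one,
    ← sub_eq_add_neg]
  have h1 : a - 1 ≠ 0 := by linarith
  have hG := Real.Gamma_add_one h1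
  rw [sub_add_cancel] at hG
  have := (Real.Gamma_pos_of_pos (sub_pos.mpr ha)).ne'
  rw [hG]
  field_simp

lemma integrable_inv_sq_gammaMeasure (ha : 2 < a) (hr : 0 < r) :
    Integrable (fun x => x⁻¹ ^ 2) (gammaMeasure a r) :=
  (integrable_rpow_gammaMeasure (by linarith) hr (by linarith)).congr
    inv_sq_ae_eq_rpow_gammaMeasure.symm

lemma integral_inv_sq_gammaMeasure (ha : 2 < a) (hr : 0 < r) :
    ∫ x, x⁻¹ ^ 2 ∂gammaMeasure a r = r ^ 2 / ((a - 1) * (a - 2)) := by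
  rw [integral_congr_ae inv_sq_ae_eq_rpow_gammaMeasure,
    integral_rpow_gammaMeasure (by linarith) hr (by linarith), neg_neg, Real.rpow_two,
    ← sub_eq_add_neg]
  have h1 : a - 1 ≠ 0 := by linarith
  have h2 : a - 2 ≠ 0 := by linarith
  have hG := Real.Gamma_add_one h1
  have hG' := Real.Gamma_add_one h2
  rw [sub_add_cancel] at hG
  rw [show a - 2 + 1 = a - 1 by ring] at hG'
  have := (Real.Gamma_pos_of_pos (sub_pos.mpr ha)).ne'
  rw [hG, hG']
  field_simp

lemma integrable_inv_sqrt_gammaMeasure (ha : 1 / 2 < a) (hr : 0 < r) :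
    Integrable (fun x => (√x)⁻¹) (gammaMeasure a r) := by
  refine (integrable_rpow_gammaMeasure (s := -(1 / 2)) (by linarith) hr (by linarith)).congr ?_
  filter_upwards [ae_pos_gammaMeasure] with x hx
  rw [Real.rpow_neg hx.le, Real.sqrt_eq_rpow]

lemma integrable_inv_mul_inv_sqrt_gammaMeasure (ha : 3 / 2 < a) (hr : 0 < r) :
    Integrable (fun x => x⁻¹ * (√x)⁻¹) (gammaMeasure a r) := by
  refine (integrable_rpow_gammaMeasure (s := -1 + -(1 / 2))
    (by linarith) hr (by linarith)).congr ?_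
  filter_upwards [ae_pos_gammaMeasure] with x hx
  rw [Real.rpow_add hx, Real.rpow_neg hx.le, Real.rpow_neg hx.le, Real.rpow_one,
    Real.sqrt_eq_rpow]

end GammaMoments

section StdGaussian

variable {n : ℕ}

lemma integrable_eval_stdGaussianPi (i : Fin n) :
    Integrable (fun z => z i) (stdGaussianPi n) := by
  have h : Integrable id (gaussianReal 0 1) := memLp_one_iff_integrable.mp
    (memLp_id_gaussianReal 1)
  exact integrable_comp_eval (μ := fun _ : Fin n => gaussianReal 0 1) h

lemma integral_eval_stdGaussianPi (i : Fin n) : ∫ z, z i ∂stdGaussianPi n = 0 := by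
  have h := integral_comp_eval (μ := fun _ : Fin n => gaussianReal 0 1) (i := i)
    (f := fun x => x) aestronglyMeasurable_id
  exact h.trans integral_id_gaussianReal

lemma memLp_two_eval_stdGaussianPi (i : Fin n) :
    MemLp (fun z => z i) 2 (stdGaussianPi n) :=
  (memLp_id_gaussianReal 2).comp_measurePreserving
    (measurePreserving_eval (fun _ : Fin n => gaussianReal 0 1) i)

lemma integrable_eval_mul_eval_stdGaussianPi (i j : Fin n) :
    Integrable (fun z => z i * z j) (stdGaussianPi n) :=
  (memLp_two_eval_stdGaussianPi i).integrable_mul (memLp_two_eval_stdGaussianPi j)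

lemma integral_eval_mul_eval_stdGaussianPi (i j : Fin n) :
    ∫ z, z i * z j ∂stdGaussianPi n = (1 : Matrix (Fin n) (Fin n) ℝ) i j := by
  rcases eq_or_ne i j with rfl | hij
  · rw [Matrix.one_apply_eq, stdGaussianPi,
      integral_comp_eval (f := fun x => x * x) (by fun_prop)]
    have h := variance_of_integral_eq_zero (X := fun x : ℝ => x) (μ := gaussianReal 0 1)
      (by fun_prop) integral_id_gaussianReal
    rw [variance_fun_id_gaussianReal] at h
    simpa [pow_two] using h.symm
  · have hind : IndepFun (fun z : Fin n → ℝ => z i) (fun z => z j) (stdGaussianPi n) :=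
      (iIndepFun_pi (μ := fun _ : Fin n => gaussianReal 0 1) (X := fun _ x => x)
        fun _ => aemeasurable_id).indepFun hij
    rw [hind.integral_fun_mul_eq_mul_integral
      (measurable_pi_apply i).aestronglyMeasurable (measurable_pi_apply j).aestronglyMeasurable,
      integral_eval_stdGaussianPi, zero_mul, Matrix.one_apply_ne hij]

end StdGaussian

section Product

variable {Ω α β : Type*} [MeasurableSpace Ω] [MeasurableSpace α] [MeasurableSpace β]
  {P : Measure Ω} {V : Ω → α} {Z : Ω → β} {f : α → ℝ} {g : β → ℝ}

lemma ProbabilityTheory.IndepFun.integrable_comp_mul_comp (h : IndepFun V Z P)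
    (hV : Measurable V) (hZ : Measurable Z) (hf : Measurable f) (hg : Measurable g)
    (hfi : Integrable f (P.map V)) (hgi : Integrable g (P.map Z)) :
    Integrable (fun ω => f (V ω) * g (Z ω)) P :=
  (h.comp hf hg).integrable_mul (hfi.comp_measurable hV) (hgi.comp_measurable hZ)

lemma ProbabilityTheory.IndepFun.integral_comp_mul_comp_eq_map (h : IndepFun V Z P)
    (hV : Measurable V) (hZ : Measurable Z) (hf : Measurable f) (hg : Measurable g) :
    ∫ ω, f (V ω) * g (Z ω) ∂P = (∫ x, f x ∂P.map V) * ∫ y, g y ∂P.map Z := by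
  rw [integral_map hV.aemeasurable hf.aestronglyMeasurable,
    integral_map hZ.aemeasurable hg.aestronglyMeasurable]
  exact (h.comp hf hg).integral_fun_mul_eq_mul_integral
    (hf.comp hV).aestronglyMeasurable (hg.comp hZ).aestronglyMeasurable

end Product

/-- Mean and covariance of the hyperbolic skew-t latent vector
`X = V⁻¹ δ + V^{−1/2} Z` with `V ∼ Gamma(ν/2, ν/2)` and `Z` standard Gaussian independent
of `V`: if `ν > 2` then `E[X] = (ν/(ν−2)) δ`, and if `ν > 4` then
`Cov(X) = (ν/(ν−2)) I_k + (2ν²/((ν−2)²(ν−4))) δᵀ δ`. -/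
theorem stmt_12 {Ω : Type*} [MeasureSpace Ω] [IsProbabilityMeasure (ℙ : Measure Ω)]
    (k : ℕ) (hk : 0 < k) (ν : ℝ) (δ : Fin k → ℝ)
    (V : Ω → ℝ) (Z : Ω → Fin k → ℝ) (hVm : Measurable V) (hZm : Measurable Z)
    (hV : Measure.map V ℙ = gammaMeasure (ν / 2) (ν / 2))
    (hZ : Measure.map Z ℙ = stdGaussianPi k)
    (hindep : IndepFun V Z ℙ)
    (X : Ω → Fin k → ℝ)
    (hX : X = fun ω => (V ω)⁻¹ • δ + (Real.sqrt (V ω))⁻¹ • Z ω) :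
    (2 < ν → meanVec X = (ν / (ν - 2)) • δ) ∧
      (4 < ν → covMatrix X = (ν / (ν - 2)) • (1 : Matrix (Fin k) (Fin k) ℝ)
          + (2 * ν ^ 2 / ((ν - 2) ^ 2 * (ν - 4))) • Matrix.vecMulVec δ δ) := by
  subst hX
  have hWm : Measurable fun x : ℝ => x⁻¹ := by fun_prop
  have hSm : Measurable fun x : ℝ => (√x)⁻¹ := by fun_prop
  have hmean : 2 < ν →
      meanVec (fun ω => (V ω)⁻¹ • δ + (√(V ω))⁻¹ • Z ω) = (ν / (ν - 2)) • δ := by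
    intro hν
    have ha : 1 < ν / 2 := by linarith
    have hr : 0 < ν / 2 := by linarith
    have hW := hV ▸ integrable_inv_gammaMeasure ha hr
    have hS := hV ▸ integrable_inv_sqrt_gammaMeasure (by linarith) hr
    funext i
    have hZi := hZ ▸ integrable_eval_stdGaussianPi i
    have hg : Measurable fun z : Fin k → ℝ => z i := measurable_pi_apply i
    have hSZ := hindep.integrable_comp_mul_comp hVm hZm hSm hg hS hZi
    have hWΩ : Integrable (fun ω => (V ω)⁻¹) ℙ := hW.comp_measurable hVm
    simp only [meanVec, Pi.add_apply, Pi.smul_apply, smul_eq_mul]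
    rw [integral_add (hWΩ.mul_const _) hSZ, integral_mul_const,
      hindep.integral_comp_mul_comp_eq_map hVm hZm hSm hg, hZ, integral_eval_stdGaussianPi,
      ← integral_map (f := fun x : ℝ => x⁻¹) hVm.aemeasurable hWm.aestronglyMeasurable, hV,
      integral_inv_gammaMeasure ha hr]
    have : ν - 2 ≠ 0 := by linarith
    have : ν / 2 - 1 ≠ 0 := by linarith
    field_simp
    ring
  refine ⟨hmean, fun hν => ?_⟩
  have ha : 2 < ν / 2 := by linarith
  have hr : 0 < ν / 2 := by linarith
  have := isProbabilityMeasure_gammaMeasure hr hr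
  set c := ν / (ν - 2) with hc
  have hW := integrable_inv_gammaMeasure (a := ν / 2) (by linarith) hr
  have hS := integrable_inv_sqrt_gammaMeasure (a := ν / 2) (by linarith) hr
  have hWS := integrable_inv_mul_inv_sqrt_gammaMeasure (a := ν / 2) (by linarith) hr
  have hW2 := integrable_inv_sq_gammaMeasure ha hr
  have hW2W : Integrable (fun x : ℝ => x⁻¹ ^ 2 - 2 * c * x⁻¹) (gammaMeasure (ν / 2) (ν / 2)) :=
    hW2.sub (hW.const_mul (2 * c))
  have hVc : Integrable (fun x : ℝ => (x⁻¹ - c) ^ 2) (gammaMeasure (ν / 2) (ν / 2)) := by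
    refine (hW2W.add (integrable_const (c ^ 2))).congr ?_
    exact ae_of_all _ fun x => by simp only [Pi.add_apply]; ring
  have hVcS : Integrable (fun x : ℝ => (x⁻¹ - c) * (√x)⁻¹) (gammaMeasure (ν / 2) (ν / 2)) := by
    refine (hWS.sub (hS.const_mul c)).congr ?_
    exact ae_of_all _ fun x => by simp only [Pi.sub_apply]; ring
  have hIW := integral_inv_gammaMeasure (a := ν / 2) (r := ν / 2) (by linarith) hr
  have hIVc : ∫ x : ℝ, (x⁻¹ - c) ^ 2 ∂gammaMeasure (ν / 2) (ν / 2)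
      = 2 * ν ^ 2 / ((ν - 2) ^ 2 * (ν - 4)) := by
    have he : ∀ x : ℝ, (x⁻¹ - c) ^ 2 = x⁻¹ ^ 2 - 2 * c * x⁻¹ + c ^ 2 := fun x => by ring
    simp_rw [he]
    rw [integral_add hW2W (integrable_const _),
      integral_sub hW2 (hW.const_mul (2 * c)), integral_const_mul, hIW,
      integral_inv_sq_gammaMeasure ha hr, integral_const, probReal_univ, one_smul, hc]
    have h1 : ν - 2 ≠ 0 := by linarith
    have h2 : ν - 4 ≠ 0 := by linarith
    rw [show ν / 2 - 1 = (ν - 2) / 2 by ring, show ν / 2 - 2 = (ν - 4) / 2 by ring]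
    field_simp
    ring
  have hpos : ∀ᵐ ω ∂(ℙ : Measure Ω), 0 < V ω :=
    ae_of_ae_map hVm.aemeasurable (hV ▸ ae_pos_gammaMeasure)
  ext i j
  have hgi : Measurable fun z : Fin k → ℝ => z i := measurable_pi_apply i
  have hgj : Measurable fun z : Fin k → ℝ => z j := measurable_pi_apply j
  have hgij : Measurable fun z : Fin k → ℝ => z i * z j := hgi.mul hgj
  have hVcm : Measurable fun x : ℝ => (x⁻¹ - c) ^ 2 := by fun_prop
  have hVcSm : Measurable fun x : ℝ => (x⁻¹ - c) * (√x)⁻¹ := by fun_prop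
  have hexp : (fun ω => (((V ω)⁻¹ • δ + (√(V ω))⁻¹ • Z ω) i - (c • δ) i)
        * (((V ω)⁻¹ • δ + (√(V ω))⁻¹ • Z ω) j - (c • δ) j)) =ᵐ[ℙ]
      fun ω => (V ω)⁻¹ * (Z ω i * Z ω j) + ((V ω)⁻¹ - c) ^ 2 * (δ i * δ j)
        + (((V ω)⁻¹ - c) * (√(V ω))⁻¹ * Z ω j * δ i
          + ((V ω)⁻¹ - c) * (√(V ω))⁻¹ * Z ω i * δ j) := by
    filter_upwards [hpos] with ω hω
    have hsq : (V ω)⁻¹ = (√(V ω))⁻¹ * (√(V ω))⁻¹ := by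
      rw [← mul_inv, Real.mul_self_sqrt hω.le]
    simp only [Pi.add_apply, Pi.smul_apply, smul_eq_mul]
    linear_combination (-(Z ω i * Z ω j)) * hsq
  have hWZZ := hindep.integrable_comp_mul_comp hVm hZm hWm hgij (hV ▸ hW)
    (hZ ▸ integrable_eval_mul_eval_stdGaussianPi i j)
  have hVcΩ : Integrable (fun ω => ((V ω)⁻¹ - c) ^ 2) ℙ := (hV ▸ hVc).comp_measurable hVm
  have hVcSZ (l : Fin k) := hindep.integrable_comp_mul_comp hVm hZm hVcSm
    (measurable_pi_apply l) (hV ▸ hVcS) (hZ ▸ integrable_eval_stdGaussianPi l)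
  have hIVcSZ (l : Fin k) : ∫ ω, ((V ω)⁻¹ - c) * (√(V ω))⁻¹ * Z ω l = 0 := by
    rw [hindep.integral_comp_mul_comp_eq_map hVm hZm hVcSm (measurable_pi_apply l), hZ,
      integral_eval_stdGaussianPi, mul_zero]
  rw [covMatrix, Matrix.of_apply, hmean (by linarith), integral_congr_ae hexp,
    integral_add (hWZZ.fun_add (hVcΩ.mul_const _))
      (((hVcSZ j).mul_const _).fun_add ((hVcSZ i).mul_const _)),
    integral_add hWZZ (hVcΩ.mul_const _),
    integral_add ((hVcSZ j).mul_const _) ((hVcSZ i).mul_const _),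
    integral_mul_const, integral_mul_const, integral_mul_const, hIVcSZ, hIVcSZ,
    hindep.integral_comp_mul_comp_eq_map hVm hZm hWm hgij, hV, hZ, hIW,
    integral_eval_mul_eval_stdGaussianPi,
    ← integral_map (f := fun x : ℝ => (x⁻¹ - c) ^ 2) hVm.aemeasurable
      hVcm.aestronglyMeasurable, hV, hIVc,
    show ν / 2 / (ν / 2 - 1) = c by
      rw [hc, show ν / 2 - 1 = (ν - 2) / 2 by ring, div_div_div_cancel_right₀ two_ne_zero]]
  simp [Matrix.vecMulVec_apply]
end
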